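/- arXiv:1311.3141 — 4 statements merged into one kernel-verified Lean document; each statement's English description precedes it below -/
import Mathlib

section
/- (Lemma 1, equality form) Fix an integer L ≥ 1, a real P > 0 and a channel vector h ∈ ℝ^L. Let a₁ ∈ ℤ^L be a nonzero integer coefficient vector and let λ ∈ ℤ with |λ| > 1. Then the computation rate of the scaled vector a₂ = λ·a₁ satisfies R(h, λ·a₁) = max( R(h, a₁) − log₂|λ| , 0 ). -/
open Finset

/-- The quadratic form `q(a) = ‖a‖² − P·(hᵀa)²/(1 + P·‖h‖²)`. -/
noncomputable def q (L : ℕ) (P : ℝ) (h : Fin L → ℝ) (a : Fin L → ℝ) : ℝ :=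
  (∑ i, a i ^ 2) - P * (∑ i, h i * a i) ^ 2 / (1 + P * ∑ i, h i ^ 2)

/-- The computation rate `R(h,a) = (1/2)·log₂⁺(q(a)⁻¹)` of an integer coefficient vector. -/
noncomputable def rate (L : ℕ) (P : ℝ) (h : Fin L → ℝ) (a : Fin L → ℤ) : ℝ :=
  (1 / 2) * max (Real.logb 2 (q L P h (fun i => (a i : ℝ)))⁻¹) 0

theorem q_pos {L : ℕ} {P : ℝ} (hP : 0 < P) (h : Fin L → ℝ) {a : Fin L → ℝ} (ha : a ≠ 0) :
    0 < q L P h a := by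
  have haa : 0 < ∑ i, a i ^ 2 := by
    obtain ⟨i, hi⟩ := Function.ne_iff.mp ha
    exact sum_pos' (fun j _ => sq_nonneg (a j)) ⟨i, mem_univ i, sq_pos_of_ne_zero hi⟩
  have cauchy := sum_mul_sq_le_sq_mul_sq univ h a
  have hden : 0 < 1 + P * ∑ i, h i ^ 2 := by positivity
  rw [q, sub_pos, div_lt_iff₀ hden]
  linarith [mul_le_mul_of_nonneg_left cauchy hP.le]

theorem q_const_mul (L : ℕ) (P : ℝ) (h a : Fin L → ℝ) (c : ℝ) :
    q L P h (fun i => c * a i) = c ^ 2 * q L P h a := by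
  have hinner : ∑ i, h i * (c * a i) = c * ∑ i, h i * a i := by
    rw [mul_sum]
    exact sum_congr rfl fun i _ => by ring
  simp only [q, hinner, mul_pow, ← mul_sum]
  ring

theorem rate_of_int_smul_eq
    (L : ℕ) (hL : 1 ≤ L) (P : ℝ) (hP : 0 < P) (h : Fin L → ℝ)
    (a₁ : Fin L → ℤ) (ha₁ : a₁ ≠ 0) (lam : ℤ) (hlam : 1 < |lam|) :
    rate L P h (fun i => lam * a₁ i) =
      max (rate L P h a₁ - Real.logb 2 |(lam : ℝ)|) 0 := by
  have ha : (fun i => (a₁ i : ℝ)) ≠ 0 := fun H =>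
    ha₁ (funext fun i => by simpa using congrFun H i)
  have hq := q_pos hP h ha
  have hlam' : (1 : ℝ) < |(lam : ℝ)| := by exact_mod_cast hlam
  have hlog : 0 < Real.logb 2 |(lam : ℝ)| := Real.logb_pos one_lt_two hlam'
  have hsq : Real.logb 2 ((lam : ℝ) ^ 2) = 2 * Real.logb 2 |(lam : ℝ)| := by
    rw [← sq_abs, Real.logb_pow, Nat.cast_ofNat]
  have hne : (lam : ℝ) ^ 2 ≠ 0 := by
    rw [← sq_abs]
    positivity
  simp only [rate, Int.cast_mul, q_const_mul, Real.logb_inv, Real.logb_mul hne hq.ne', hsq]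
  grind
end

section
/- (Top-coalition property of the C&F game) Let V be a nonempty subset of the player set N and suppose there exists a coalition S* ⊆ V with C ∈ S*, |S*| = L + 1, and v(S*) ≥ v(T) for every coalition T ⊆ V. Then S* is a top coalition of V: for every player i ∈ S* and every nonempty coalition T ⊆ V with i ∈ T, one has φ_i(S*) ≥ φ_i(T). -/
open Finset

/-- Payoff of player `i` in a coalition `S` containing `i`: the centralized decoder `C`
receives `(1 − b)·v(S)` and each relay receives `b·v(S)/(|S| − 1)`. -/
noncomputable def phi {N : Type*} [Fintype N] [DecidableEq N]
    (C : N) (b : ℝ) (v : Finset N → ℝ) (i : N) (S : Finset N) : ℝ :=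
  if i = C then (1 - b) * v S else b * v S / ((S.card : ℝ) - 1)

theorem top_coalition_property {N : Type*} [Fintype N] [DecidableEq N]
    (C : N) (L : ℕ) (hL : 1 ≤ L) (v : Finset N → ℝ)
    (hv0 : ∀ S : Finset N, 0 ≤ v S)
    (hvC : ∀ S : Finset N, C ∉ S → v S = 0)
    (hvL : ∀ S : Finset N, S.card < L + 1 → v S = 0)
    (b : ℝ) (hb0 : 0 < b) (hb1 : b < 1)
    (V : Finset N) (hV : V.Nonempty)
    (Sstar : Finset N) (hSV : Sstar ⊆ V) (hC : C ∈ Sstar)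
    (hcard : Sstar.card = L + 1)
    (hmax : ∀ T : Finset N, T ⊆ V → v T ≤ v Sstar) :
    ∀ i ∈ Sstar, ∀ T : Finset N, T ⊆ V → T.Nonempty → i ∈ T →
      phi C b v i Sstar ≥ phi C b v i T := by
  intro i _ T hTV _ _
  have hL' : (1 : ℝ) ≤ L := by exact_mod_cast hL
  have hle := hmax T hTV
  unfold phi
  split_ifs with hi
  · exact mul_le_mul_of_nonneg_left hle (by linarith)
  · have hS : (Sstar.card : ℝ) - 1 = L := by simp [hcard]
    rw [hS]
    rcases lt_or_ge T.card (L + 1) with hT | hT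
    · rw [hvL T hT, mul_zero, zero_div]
      exact div_nonneg (mul_nonneg hb0.le (hv0 Sstar)) (by linarith)
    · have hT' : (L : ℝ) + 1 ≤ T.card := by exact_mod_cast hT
      exact div_le_div₀ (mul_nonneg hb0.le (hv0 Sstar))
        (mul_le_mul_of_nonneg_left hle hb0.le) (by linarith) (by linarith)
end

section
/- (Theorem 2: core partition) Suppose there exists a coalition S* ⊆ N with C ∈ S*, |S*| = L + 1, and v(S*) ≥ v(T) for every coalition T ⊆ N. Let π* be the partition of N consisting of S* together with the singletons {i} for every player i ∉ S*, and for i ∈ N write π*(i) for the block of π* containing i (so π*(i) = S* if i ∈ S*, and π*(i) = {i} otherwise). Then π* admits no profitable coalitional deviation: there is no nonempty coalition T ⊆ N such that φ_i(T) > φ_i(π*(i)) for every i ∈ T. -/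
open Finset

theorem core_partition_no_profitable_deviation {N : Type*} [Fintype N] [DecidableEq N]
    (C : N) (L : ℕ) (hL : 1 ≤ L) (v : Finset N → ℝ)
    (hv0 : ∀ S : Finset N, 0 ≤ v S)
    (hvC : ∀ S : Finset N, C ∉ S → v S = 0)
    (hvL : ∀ S : Finset N, S.card < L + 1 → v S = 0)
    (b : ℝ) (hb0 : 0 < b) (hb1 : b < 1)
    (Sstar : Finset N) (hC : C ∈ Sstar) (hcard : Sstar.card = L + 1)
    (hmax : ∀ T : Finset N, v T ≤ v Sstar) :
    ¬ ∃ T : Finset N, T.Nonempty ∧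
        ∀ i ∈ T, phi C b v i T >
          phi C b v i (if i ∈ Sstar then Sstar else {i}) := by
  rintro ⟨T, ⟨i, hi⟩, hT⟩
  by_cases hCT : C ∈ T
  · have h := hT C hCT
    simp only [phi, if_pos hC, if_true] at h
    have := mul_le_mul_of_nonneg_left (hmax T) (sub_nonneg.mpr hb1.le)
    linarith
  · have hiC : i ≠ C := fun h => hCT (h ▸ hi)
    have h := hT i hi
    simp only [phi, if_neg hiC, hvC T hCT, mul_zero, zero_div] at h
    refine absurd h (not_lt.mpr ?_)
    split_ifs with hiS
    · rw [hcard]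
      push_cast
      rw [add_sub_cancel_right]
      exact div_nonneg (mul_nonneg hb0.le (hv0 _)) L.cast_nonneg
    · have hz : v {i} = 0 := hvL _ (by rw [card_singleton]; lia)
      simp [hz]
end

section
/- (Theorem 1: non-emptiness of the core) Suppose there exists a coalition S* ⊆ N with C ∈ S*, |S*| = L + 1, and v(S*) ≥ v(T) for every coalition T ⊆ N. Then the game has a non-empty core: there exists a partition π of the player set N such that no nonempty coalition T ⊆ N satisfies φ_i(T) > φ_i(π(i)) for every i ∈ T, where π(i) denotes the block of π containing i. -/
open Finset

theorem core_nonempty {N : Type*} [Fintype N] [DecidableEq N]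
    (C : N) (L : ℕ) (hL : 1 ≤ L) (v : Finset N → ℝ)
    (hv0 : ∀ S : Finset N, 0 ≤ v S)
    (hvC : ∀ S : Finset N, C ∉ S → v S = 0)
    (hvL : ∀ S : Finset N, S.card < L + 1 → v S = 0)
    (b : ℝ) (hb0 : 0 < b) (hb1 : b < 1)
    (Sstar : Finset N) (hC : C ∈ Sstar) (hcard : Sstar.card = L + 1)
    (hmax : ∀ T : Finset N, v T ≤ v Sstar) :
    ∃ blk : N → Finset N,
      (∀ i : N, i ∈ blk i) ∧
      (∀ i j : N, j ∈ blk i → blk j = blk i) ∧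
      ¬ ∃ T : Finset N, T.Nonempty ∧
          ∀ i ∈ T, phi C b v i T > phi C b v i (blk i) := by
  refine ⟨fun i => if i ∈ Sstar then Sstar else Sstarᶜ, fun i => ?_, fun i j hj => ?_, ?_⟩
  · by_cases hi : i ∈ Sstar <;> simp [hi]
  · by_cases hi : i ∈ Sstar
    · simp only [hi, if_true] at hj
      simp [hi, hj]
    · simp only [hi, if_false, mem_compl] at hj
      simp [hi, hj]
  · rintro ⟨T, ⟨i, hi⟩, hT⟩
    by_cases hCT : C ∈ T
    · have h := hT C hCT
      simp only [phi, hC, if_true] at h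
      exact absurd (lt_of_mul_lt_mul_left h (sub_nonneg.mpr hb1.le)) (hmax T).not_gt
    · have hiC : i ≠ C := fun h => hCT (h ▸ hi)
      have h := hT i hi
      simp only [phi, hiC, if_false, hvC T hCT, mul_zero, zero_div] at h
      refine absurd h (not_lt.mpr ?_)
      by_cases hiS : i ∈ Sstar
      · simp only [hiS, if_true, hcard, Nat.cast_add, Nat.cast_one, add_sub_cancel_right]
        exact div_nonneg (mul_nonneg hb0.le (hv0 _)) L.cast_nonneg
      · have hz : v Sstarᶜ = 0 := hvC _ (by simpa using hC)
        simp [hiS, hz]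
end
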